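/- Thompson's group F does not have the Liouville property: letting G be the group of bijections of the unit interval [0,1] generated by A and B (which is Thompson's group F), there exists a bounded nonconstant function h : G → ℝ such that for every g ∈ G, h(g) = (1/4)·( h(g∘A) + h(g∘A⁻¹) + h(g∘B) + h(g∘B⁻¹) ); that is, h is harmonic for the simple random walk on G driven by the uniform measure on {A, A⁻¹, B, B⁻¹}. -/

import Mathlib

/-- The generator `A` of Thompson's group `F` (as a map of `ℝ`). -/
noncomputable def Amap (x : ℝ) : ℝ :=
  if x ≤ 1/2 then x/2 else if x ≤ 3/4 then x - 1/4 else 2*x - 1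

/-- The inverse of `Amap`. -/
noncomputable def Ainvmap (y : ℝ) : ℝ :=
  if y ≤ 1/4 then 2*y else if y ≤ 1/2 then y + 1/4 else (y + 1)/2

/-- The generator `B` of Thompson's group `F` (as a map of `ℝ`). -/
noncomputable def Bmap (x : ℝ) : ℝ :=
  if x ≤ 1/2 then x else if x ≤ 3/4 then x/2 + 1/4 else if x ≤ 7/8 then x - 1/8 else 2*x - 1

/-- The inverse of `Bmap`. -/
noncomputable def Binvmap (y : ℝ) : ℝ :=
  if y ≤ 1/2 then y else if y ≤ 5/8 then 2*y - 1/2 else if y ≤ 3/4 then y + 1/8 else (y + 1)/2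

/-- `A` as a bijection of the unit interval `[0,1]`. -/
noncomputable def permA : Equiv.Perm (Set.Icc (0:ℝ) 1) where
  toFun x := ⟨Amap x.1, by
    have hx := x.2; rw [Set.mem_Icc] at hx ⊢
    unfold Amap; split_ifs <;> constructor <;> linarith [hx.1, hx.2]⟩
  invFun y := ⟨Ainvmap y.1, by
    have hy := y.2; rw [Set.mem_Icc] at hy ⊢
    unfold Ainvmap; split_ifs <;> constructor <;> linarith [hy.1, hy.2]⟩
  left_inv := by
    rintro ⟨x, hx⟩; rw [Set.mem_Icc] at hx
    apply Subtype.ext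
    show Ainvmap (Amap x) = x
    unfold Amap Ainvmap; split_ifs <;> linarith [hx.1, hx.2]
  right_inv := by
    rintro ⟨y, hy⟩; rw [Set.mem_Icc] at hy
    apply Subtype.ext
    show Amap (Ainvmap y) = y
    unfold Amap Ainvmap; split_ifs <;> linarith [hy.1, hy.2]

set_option maxHeartbeats 1600000 in
/-- `B` as a bijection of the unit interval `[0,1]`. -/
noncomputable def permB : Equiv.Perm (Set.Icc (0:ℝ) 1) where
  toFun x := ⟨Bmap x.1, by
    have hx := x.2; rw [Set.mem_Icc] at hx ⊢
    unfold Bmap; split_ifs <;> constructor <;> linarith [hx.1, hx.2]⟩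
  invFun y := ⟨Binvmap y.1, by
    have hy := y.2; rw [Set.mem_Icc] at hy ⊢
    unfold Binvmap; split_ifs <;> constructor <;> linarith [hy.1, hy.2]⟩
  left_inv := by
    rintro ⟨x, hx⟩; rw [Set.mem_Icc] at hx
    apply Subtype.ext
    show Binvmap (Bmap x) = x
    unfold Bmap Binvmap; split_ifs <;> linarith [hx.1, hx.2]
  right_inv := by
    rintro ⟨y, hy⟩; rw [Set.mem_Icc] at hy
    apply Subtype.ext
    show Bmap (Binvmap y) = y
    unfold Bmap Binvmap; split_ifs <;> linarith [hy.1, hy.2]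

/-- Thompson's group `F`, as the group of bijections of `[0,1]` generated by `A` and `B`. -/
noncomputable def thompsonF : Subgroup (Equiv.Perm (Set.Icc (0:ℝ) 1)) :=
  Subgroup.closure {permA, permB}

noncomputable def genA : thompsonF :=
  ⟨permA, Subgroup.subset_closure (Set.mem_insert _ _)⟩

noncomputable def genB : thompsonF :=
  ⟨permB, Subgroup.subset_closure (Set.mem_insert_of_mem _ rfl)⟩

open Set

/-! ### Dyadic valuation -/

/-- The least `n` such that `u * 2 ^ n` is an integer (`0` if there is none). -/
noncomputable def dyadicExp (u : ℝ) : ℕ := sInf {n | ∃ k : ℤ, u * 2 ^ n = k}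

lemma dyadicExp_add_one {u w : ℝ} (hu : ∀ k : ℤ, u ≠ k)
    (h : ∀ n : ℕ, (∃ k : ℤ, u * 2 ^ (n + 1) = k) ↔ ∃ k : ℤ, w * 2 ^ n = k)
    (hw : ∃ n : ℕ, ∃ k : ℤ, w * 2 ^ n = k) : dyadicExp u = dyadicExp w + 1 := by
  have hne : {n : ℕ | ∃ k : ℤ, u * 2 ^ n = k}.Nonempty := by
    obtain ⟨n, hn⟩ := hw
    exact ⟨n + 1, (h n).2 hn⟩
  have h1 : 1 ≤ sInf {n : ℕ | ∃ k : ℤ, u * 2 ^ n = k} := by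
    rcases Nat.eq_zero_or_pos (sInf {n : ℕ | ∃ k : ℤ, u * 2 ^ n = k}) with h0 | h0
    · obtain ⟨k, hk⟩ := Nat.sInf_mem hne
      rw [h0] at hk
      exact absurd (by simpa using hk) (hu k)
    · exact h0
  unfold dyadicExp
  rw [← Nat.sInf_add h1]
  simp only [h]

lemma dyadicExp_eq_zero {u : ℝ} (h : ¬ ∃ n : ℕ, ∃ k : ℤ, u * 2 ^ n = k) : dyadicExp u = 0 := by
  have : {n : ℕ | ∃ k : ℤ, u * 2 ^ n = k} = ∅ := by
    ext n
    simpa using fun k hk => h ⟨n, k, hk⟩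
  rw [dyadicExp, this, Nat.sInf_empty]

lemma ne_intCast_of_mem_Ioo {u : ℝ} (h0 : 0 < u) (h1 : u < 1) (k : ℤ) : u ≠ k := by
  rintro rfl
  have h0' : 0 < k := by exact_mod_cast h0
  have h1' : k < 1 := by exact_mod_cast h1
  omega

lemma dyadicExp_ne_zero {u : ℝ} (h0 : 0 < u) (h1 : u < 1)
    (h : ∃ n : ℕ, ∃ k : ℤ, u * 2 ^ n = k) : dyadicExp u ≠ 0 := by
  intro hz
  obtain ⟨k, hk⟩ := Nat.sInf_mem (s := {n : ℕ | ∃ k : ℤ, u * 2 ^ n = k}) h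
  change u * 2 ^ dyadicExp u = k at hk
  rw [hz] at hk
  exact ne_intCast_of_mem_Ioo h0 h1 k (by simpa using hk)

lemma dyadic_half_iff (u : ℝ) (n : ℕ) :
    (∃ k : ℤ, u / 2 * 2 ^ (n + 1) = k) ↔ ∃ k : ℤ, u * 2 ^ n = k := by
  have : u / 2 * 2 ^ (n + 1) = u * 2 ^ n := by ring
  rw [this]

lemma dyadic_half_add_iff (u : ℝ) (n : ℕ) :
    (∃ k : ℤ, (1 + u) / 2 * 2 ^ (n + 1) = k) ↔ ∃ k : ℤ, u * 2 ^ n = k := by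
  have : (1 + u) / 2 * 2 ^ (n + 1) = u * 2 ^ n + 2 ^ n := by ring
  rw [this]
  constructor
  · rintro ⟨k, hk⟩
    exact ⟨k - 2 ^ n, by push_cast; linarith⟩
  · rintro ⟨k, hk⟩
    exact ⟨k + 2 ^ n, by push_cast; linarith⟩

lemma dyadic_of_mul_two {u w : ℝ}
    (h : ∀ n : ℕ, (∃ k : ℤ, u * 2 ^ (n + 1) = k) ↔ ∃ k : ℤ, w * 2 ^ n = k)
    (hu : ∃ n : ℕ, ∃ k : ℤ, u * 2 ^ n = k) : ∃ n : ℕ, ∃ k : ℤ, w * 2 ^ n = k := by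
  obtain ⟨n, k, hk⟩ := hu
  exact ⟨n, (h n).1 ⟨2 * k, by push_cast; rw [← hk]; ring⟩⟩

/-! ### A bounded potential on the dyadic tree

The vertices of the binary tree are the dyadic numbers in `(0, 1)`; the children of `u` are
`u / 2` and `(1 + u) / 2`. -/

/-- The flow through the vertex `u`: it starts from `14` at the root `1 / 2` and splits evenly. -/
noncomputable def treeFlow (u : ℝ) : ℝ := if dyadicExp u = 0 then 0 else 28 / 2 ^ dyadicExp u

/-- The potential at a vertex of depth `n`, by recursion on `n`. -/
noncomputable def treePotAux : ℕ → ℝ → ℝ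
  | 0, _ => 0
  | 1, _ => 19
  | n + 2, u => treePotAux (n + 1) (Int.fract (2 * u)) +
      (if u < 1 / 2 then 1 / 2 else 1) * (28 / 2 ^ (n + 1))

/-- The potential of the flow `treeFlow`, with edges to left children of resistance `1` and edges
to right children of resistance `2`. -/
noncomputable def treePot (u : ℝ) : ℝ := treePotAux (dyadicExp u) u

lemma treePotAux_bounds (n : ℕ) (u : ℝ) :
    0 ≤ treePotAux (n + 1) u ∧ treePotAux (n + 1) u ≤ 47 - 56 / 2 ^ (n + 1) := by
  induction n generalizing u with
  | zero => norm_num [treePotAux]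
  | succ n ih =>
    obtain ⟨h1, h2⟩ := ih (Int.fract (2 * u))
    have hp : (0 : ℝ) < 28 / 2 ^ (n + 1) := by positivity
    have e1 : (56 : ℝ) / 2 ^ (n + 1) = 2 * (28 / 2 ^ (n + 1)) := by ring
    have e2 : (56 : ℝ) / 2 ^ (n + 1 + 1) = 28 / 2 ^ (n + 1) := by rw [pow_succ _ (n + 1)]; ring
    rw [treePotAux, e2]
    rw [e1] at h2
    split_ifs <;> constructor <;> linarith

lemma abs_treePot_le (u : ℝ) : |treePot u| ≤ 47 := by
  unfold treePot
  rcases dyadicExp u with _ | n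
  · norm_num [treePotAux]
  · obtain ⟨h1, h2⟩ := treePotAux_bounds n u
    have hp : (0 : ℝ) < 56 / 2 ^ (n + 1) := by positivity
    rw [abs_of_nonneg h1]
    linarith

lemma abs_treeFlow_le (u : ℝ) : |treeFlow u| ≤ 28 := by
  unfold treeFlow
  split_ifs
  · norm_num
  · rw [abs_of_nonneg (by positivity)]
    exact div_le_self (by norm_num) (one_le_pow₀ (by norm_num))

lemma tree_child {u w : ℝ} (hu0 : 0 < u) (hu1 : u < 1) (hw0 : 0 < w) (hw1 : w < 1)
    (hf : Int.fract (2 * u) = w)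
    (h : ∀ n : ℕ, (∃ k : ℤ, u * 2 ^ (n + 1) = k) ↔ ∃ k : ℤ, w * 2 ^ n = k) :
    treeFlow u = treeFlow w / 2 ∧
      treePot u = treePot w + (if u < 1 / 2 then 1 / 2 else 1) * treeFlow w := by
  by_cases hw : ∃ n : ℕ, ∃ k : ℤ, w * 2 ^ n = k
  · have hwz := dyadicExp_ne_zero hw0 hw1 hw
    have hu := dyadicExp_add_one (ne_intCast_of_mem_Ioo hu0 hu1) h hw
    obtain ⟨n, hn⟩ := Nat.exists_eq_succ_of_ne_zero hwz
    rw [Nat.succ_eq_add_one] at hn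
    unfold treeFlow treePot
    rw [hu, hn]
    simp only [treePotAux, hf]
    refine ⟨?_, by simp⟩
    simp only [Nat.add_eq_zero_iff, one_ne_zero, and_false, if_false]
    rw [pow_succ _ (n + 1)]
    ring
  · have hu : ¬ ∃ n : ℕ, ∃ k : ℤ, u * 2 ^ n = k := fun hu => hw (dyadic_of_mul_two h hu)
    simp [treeFlow, treePot, dyadicExp_eq_zero hw, dyadicExp_eq_zero hu, treePotAux]

lemma treeFlow_half {u : ℝ} (h0 : 0 < u) (h1 : u < 1) :
    treeFlow (u / 2) = treeFlow u / 2 ∧ treePot (u / 2) = treePot u + treeFlow u / 2 := by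
  have hf : Int.fract (2 * (u / 2)) = u := by
    rw [mul_div_cancel₀ u two_ne_zero]
    exact Int.fract_eq_self.2 ⟨h0.le, h1⟩
  obtain ⟨e1, e2⟩ := tree_child (u := u / 2) (by linarith) (by linarith) h0 h1 hf
    (dyadic_half_iff u)
  rw [if_pos (by linarith)] at e2
  exact ⟨e1, by rw [e2]; ring⟩

lemma treeFlow_half_add {u : ℝ} (h0 : 0 < u) (h1 : u < 1) :
    treeFlow ((1 + u) / 2) = treeFlow u / 2 ∧ treePot ((1 + u) / 2) = treePot u + treeFlow u := by
  have hf : Int.fract (2 * ((1 + u) / 2)) = u := by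
    rw [mul_div_cancel₀ _ two_ne_zero, add_comm, Int.fract_add_one]
    exact Int.fract_eq_self.2 ⟨h0.le, h1⟩
  obtain ⟨e1, e2⟩ := tree_child (u := (1 + u) / 2) (by linarith) (by linarith) h0 h1 hf
    (dyadic_half_add_iff u)
  rw [if_neg (by linarith)] at e2
  exact ⟨e1, by rw [e2]; ring⟩

lemma dyadicExp_one_half : dyadicExp (1 / 2) = 1 := by
  have h := dyadicExp_add_one (u := (1 + 0) / 2) (w := 0)
    (ne_intCast_of_mem_Ioo (by norm_num) (by norm_num)) (dyadic_half_add_iff 0) ⟨0, 0, by simp⟩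
  have h0 : dyadicExp 0 = 0 := Nat.sInf_eq_zero.2 (Or.inl ⟨0, by simp⟩)
  rw [h0, add_zero] at h
  exact h

lemma treePot_one_half : treePot (1 / 2) = 19 := by
  rw [treePot, dyadicExp_one_half, treePotAux]

lemma treeFlow_one_half : treeFlow (1 / 2) = 14 := by
  rw [treeFlow, dyadicExp_one_half]
  norm_num

/-! ### The binary tails at the two endpoints -/

/-- Sends `0.0…01w` to `0.w` in binary. -/
noncomputable def lowTail (x : ℝ) : ℝ := x / 2 ^ Int.log 2 x - 1

/-- Sends `0.1…10w` to `0.w` in binary. -/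
noncomputable def highTail (x : ℝ) : ℝ := 2 - 2 * (1 - x) / 2 ^ Int.clog 2 (1 - x)

lemma log_two_eq {x : ℝ} {k : ℤ} (h1 : 2 ^ k ≤ x) (h2 : x < 2 ^ (k + 1)) : Int.log 2 x = k := by
  have hx : 0 < x := lt_of_lt_of_le (by positivity) h1
  have a := (Int.zpow_le_iff_le_log (b := 2) (by norm_num) hx (x := k)).1 (by exact_mod_cast h1)
  have b := (Int.lt_zpow_iff_log_lt (b := 2) (by norm_num) hx (x := k + 1)).1 (by exact_mod_cast h2)
  omega

lemma clog_two_eq {x : ℝ} {k : ℤ} (hx : 0 < x) (h1 : 2 ^ (k - 1) < x) (h2 : x ≤ 2 ^ k) :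
    Int.clog 2 x = k := by
  have a := (Int.zpow_lt_iff_lt_clog (b := 2) (by norm_num) hx (x := k - 1)).1
    (by exact_mod_cast h1)
  have b := (Int.le_zpow_iff_clog_le (b := 2) (by norm_num) hx (x := k)).1 (by exact_mod_cast h2)
  omega

lemma lowTail_half {x : ℝ} (hx : 0 < x) : lowTail (x / 2) = lowTail x := by
  have a : (2 : ℝ) ^ Int.log 2 x ≤ x := by
    exact_mod_cast Int.zpow_log_le_self (b := 2) (by norm_num) hx
  have b : x < (2 : ℝ) ^ (Int.log 2 x + 1) := by
    exact_mod_cast Int.lt_zpow_succ_log_self (b := 2) (by norm_num) x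
  rw [zpow_add_one₀ two_ne_zero] at b
  have e : Int.log 2 (x / 2) = Int.log 2 x - 1 := by
    apply log_two_eq
    · rw [zpow_sub_one₀ two_ne_zero]; linarith
    · rw [sub_add_cancel]; linarith
  rw [lowTail, lowTail, e, zpow_sub_one₀ two_ne_zero]
  field_simp

lemma lowTail_of_mem {x : ℝ} (h1 : 1 / 4 ≤ x) (h2 : x < 1 / 2) : lowTail x = 4 * x - 1 := by
  have e : Int.log 2 x = -2 := log_two_eq (by norm_num; linarith) (by norm_num; linarith)
  rw [lowTail, e]
  norm_num
  ring

lemma highTail_half_add {x : ℝ} (hx : x < 1) : highTail ((x + 1) / 2) = highTail x := by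
  have hp : 0 < 1 - x := by linarith
  have a : 1 - x ≤ (2 : ℝ) ^ Int.clog 2 (1 - x) := by
    exact_mod_cast Int.self_le_zpow_clog (b := 2) (by norm_num) (1 - x)
  have b : (2 : ℝ) ^ (Int.clog 2 (1 - x) - 1) < 1 - x := by
    exact_mod_cast Int.zpow_pred_clog_lt_self (b := 2) (by norm_num) hp
  rw [zpow_sub_one₀ two_ne_zero] at b
  have e0 : 1 - (x + 1) / 2 = (1 - x) / 2 := by ring
  have e : Int.clog 2 ((1 - x) / 2) = Int.clog 2 (1 - x) - 1 := by
    apply clog_two_eq (by linarith)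
    · rw [zpow_sub_one₀ two_ne_zero, zpow_sub_one₀ two_ne_zero]; linarith
    · rw [zpow_sub_one₀ two_ne_zero]; linarith
  rw [highTail, highTail, e0, e, zpow_sub_one₀ two_ne_zero]
  field_simp

lemma highTail_of_mem {x : ℝ} (h1 : 3 / 4 ≤ x) (h2 : x < 7 / 8) : highTail x = 8 * x - 6 := by
  have e : Int.clog 2 (1 - x) = -2 :=
    clog_two_eq (by linarith) (by norm_num; linarith) (by norm_num; linarith)
  rw [highTail, e]
  norm_num
  ring

/-! ### The twisted harmonic function on the interval -/

/-- A bounded function on the orbit of `1 / 2`, harmonic up to the signs given by the parity of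
the breaks of the generators. -/
noncomputable def twistedPot (x : ℝ) : ℝ :=
  if x = 1 / 2 then 1
  else if x < 1 / 2 then (if lowTail x = 0 then -1 else treePot (lowTail x))
  else if x < 3 / 4 then treePot (4 * x - 2)
  else if highTail x = 0 then (if x = 3 / 4 then -5 else 0)
  else treePot (highTail x) + treeFlow (highTail x) / 2

lemma abs_twistedPot_le (x : ℝ) : |twistedPot x| ≤ 61 := by
  unfold twistedPot
  have h1 := abs_treePot_le (lowTail x)
  have h2 := abs_treePot_le (4 * x - 2)
  have h3 := abs_treePot_le (highTail x)
  have h4 := abs_treeFlow_le (highTail x)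
  rw [abs_le] at *
  split_ifs <;> constructor <;> linarith

lemma twistedPot_one_half : twistedPot (1 / 2) = 1 := if_pos rfl

lemma twistedPot_half {x : ℝ} (h0 : 0 < x) (h1 : x < 1 / 2) :
    twistedPot (x / 2) = twistedPot x := by
  simp only [twistedPot]
  rw [if_neg (by linarith), if_pos (by linarith), if_neg h1.ne, if_pos h1, lowTail_half h0]

lemma twistedPot_one_quarter : twistedPot (1 / 4) = -1 := by
  rw [twistedPot, if_neg (by norm_num), if_pos (by norm_num),
    if_pos (by rw [lowTail_of_mem (by norm_num) (by norm_num)]; norm_num)]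

lemma twistedPot_low {x : ℝ} (h0 : 1 / 4 < x) (h1 : x < 1 / 2) :
    twistedPot x = treePot (4 * x - 1) := by
  rw [twistedPot, if_neg h1.ne, if_pos h1, lowTail_of_mem h0.le h1, if_neg (by linarith)]

lemma twistedPot_mid {x : ℝ} (h0 : 1 / 2 < x) (h1 : x < 3 / 4) :
    twistedPot x = treePot (4 * x - 2) := by
  rw [twistedPot, if_neg h0.ne', if_neg h0.not_gt, if_pos h1]

lemma twistedPot_three_quarters : twistedPot (3 / 4) = -5 := by
  rw [twistedPot, if_neg (by norm_num), if_neg (by norm_num), if_neg (by norm_num),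
    if_pos (by rw [highTail_of_mem (by norm_num) (by norm_num)]; norm_num), if_pos rfl]

lemma twistedPot_high {x : ℝ} (h0 : 3 / 4 < x) (h1 : x < 7 / 8) :
    twistedPot x = treePot (8 * x - 6) + treeFlow (8 * x - 6) / 2 := by
  rw [twistedPot, if_neg (by linarith), if_neg (by linarith), if_neg (by linarith),
    highTail_of_mem h0.le h1, if_neg (by linarith)]

lemma twistedPot_half_add {x : ℝ} (h0 : 3 / 4 < x) (h1 : x < 1) :
    twistedPot ((x + 1) / 2) = twistedPot x := by
  have key : ∀ y : ℝ, 3 / 4 < y → twistedPot y = if highTail y = 0 then 0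
      else treePot (highTail y) + treeFlow (highTail y) / 2 := by
    intro y hy
    rw [twistedPot, if_neg (by linarith), if_neg (by linarith), if_neg (by linarith),
      if_neg (show y ≠ 3 / 4 from hy.ne')]
  rw [key x h0, key _ (by linarith), highTail_half_add h1]

lemma twistedPot_seven_eighths : twistedPot (7 / 8) = 0 := by
  have h : highTail ((3 / 4 + 1) / 2) = 0 := by
    rw [highTail_half_add (by norm_num), highTail_of_mem (by norm_num) (by norm_num)]
    norm_num
  norm_num at h
  norm_num [twistedPot, h]

/-! ### Breaks of the generators -/

/-- Exponent of the break of `A` at `x`. -/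
noncomputable def breakA (x : ℝ) : ℤ := if x = 1 / 2 then 1 else if x = 3 / 4 then 1 else 0

/-- Exponent of the break of `A⁻¹` at `x`. -/
noncomputable def breakAinv (x : ℝ) : ℤ := if x = 1 / 4 then -1 else if x = 1 / 2 then -1 else 0

/-- Exponent of the break of `B` at `x`. -/
noncomputable def breakB (x : ℝ) : ℤ :=
  if x = 1 / 2 then -1 else if x = 3 / 4 then 1 else if x = 7 / 8 then 1 else 0

/-- Exponent of the break of `B⁻¹` at `x`. -/
noncomputable def breakBinv (x : ℝ) : ℤ :=
  if x = 1 / 2 then 1 else if x = 5 / 8 then -1 else if x = 3 / 4 then -1 else 0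

lemma twistedPot_harmonic_low {x : ℝ} (h0 : 0 < x) (h1 : x < 1 / 2) :
    4 * twistedPot x = (-1) ^ breakA x * twistedPot (Amap x) +
      (-1) ^ breakAinv x * twistedPot (Ainvmap x) +
      (-1) ^ breakB x * twistedPot (Bmap x) + (-1) ^ breakBinv x * twistedPot (Binvmap x) := by
  have e1 : Amap x = x / 2 := if_pos h1.le
  have e3 : Bmap x = x := if_pos h1.le
  have e4 : Binvmap x = x := if_pos h1.le
  have b1 : breakA x = 0 := by
    rw [breakA, if_neg (by linarith), if_neg (by linarith)]
  have b3 : breakB x = 0 := by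
    rw [breakB, if_neg (by linarith), if_neg (by linarith), if_neg (by linarith)]
  have b4 : breakBinv x = 0 := by
    rw [breakBinv, if_neg (by linarith), if_neg (by linarith), if_neg (by linarith)]
  rw [e1, e3, e4, b1, b3, b4, twistedPot_half h0 h1]
  simp only [zpow_zero, one_mul]
  suffices h : (-1) ^ breakAinv x * twistedPot (Ainvmap x) = twistedPot x by rw [h]; ring
  rcases lt_trichotomy x (1 / 4) with h | rfl | h
  · rw [breakAinv, if_neg (by linarith), if_neg (by linarith), Ainvmap, if_pos h.le]
    have := twistedPot_half (x := 2 * x) (by linarith) (by linarith)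
    rw [mul_div_cancel_left₀ _ two_ne_zero] at this
    simp [this]
  · rw [breakAinv, if_pos rfl, Ainvmap, if_pos le_rfl, twistedPot_one_quarter]
    norm_num [twistedPot_one_half]
  · rw [breakAinv, if_neg (by linarith), if_neg (by linarith), Ainvmap, if_neg (by linarith),
      if_pos h1.le, twistedPot_low h h1, twistedPot_mid (by linarith) (by linarith)]
    simp only [zpow_zero, one_mul]
    congr 1
    ring

lemma twistedPot_harmonic_one_half :
    4 * twistedPot (1 / 2) = (-1) ^ breakA (1 / 2) * twistedPot (Amap (1 / 2)) +
      (-1) ^ breakAinv (1 / 2) * twistedPot (Ainvmap (1 / 2)) +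
      (-1) ^ breakB (1 / 2) * twistedPot (Bmap (1 / 2)) +
      (-1) ^ breakBinv (1 / 2) * twistedPot (Binvmap (1 / 2)) := by
  have e1 : Amap (1 / 2) = 1 / 4 := by norm_num [Amap]
  have e2 : Ainvmap (1 / 2) = 3 / 4 := by norm_num [Ainvmap]
  have e3 : Bmap (1 / 2) = 1 / 2 := by norm_num [Bmap]
  have e4 : Binvmap (1 / 2) = 1 / 2 := by norm_num [Binvmap]
  have b1 : breakA (1 / 2) = 1 := by norm_num [breakA]
  have b2 : breakAinv (1 / 2) = -1 := by norm_num [breakAinv]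
  have b3 : breakB (1 / 2) = -1 := by norm_num [breakB]
  have b4 : breakBinv (1 / 2) = 1 := by norm_num [breakBinv]
  rw [e1, e2, e3, e4, b1, b2, b3, b4, twistedPot_one_half, twistedPot_one_quarter,
    twistedPot_three_quarters]
  norm_num

lemma twistedPot_harmonic_mid {x : ℝ} (h0 : 1 / 2 < x) (h1 : x < 3 / 4) :
    4 * twistedPot x = (-1) ^ breakA x * twistedPot (Amap x) +
      (-1) ^ breakAinv x * twistedPot (Ainvmap x) +
      (-1) ^ breakB x * twistedPot (Bmap x) + (-1) ^ breakBinv x * twistedPot (Binvmap x) := by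
  have e1 : Amap x = x - 1 / 4 := by rw [Amap, if_neg (by linarith), if_pos h1.le]
  have e2 : Ainvmap x = (x + 1) / 2 := by rw [Ainvmap, if_neg (by linarith), if_neg (by linarith)]
  have e3 : Bmap x = x / 2 + 1 / 4 := by rw [Bmap, if_neg (by linarith), if_pos h1.le]
  have b1 : breakA x = 0 := by
    rw [breakA, if_neg (by linarith), if_neg (by linarith)]
  have b2 : breakAinv x = 0 := by
    rw [breakAinv, if_neg (by linarith), if_neg (by linarith)]
  have b3 : breakB x = 0 := by
    rw [breakB, if_neg (by linarith), if_neg (by linarith), if_neg (by linarith)]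
  obtain ⟨-, hc⟩ := treeFlow_half (u := 4 * x - 2) (by linarith) (by linarith)
  rw [e1, e2, e3, b1, b2, b3, twistedPot_mid h0 h1,
    twistedPot_low (x := x - 1 / 4) (by linarith) (by linarith),
    twistedPot_high (x := (x + 1) / 2) (by linarith) (by linarith),
    twistedPot_mid (x := x / 2 + 1 / 4) (by linarith) (by linarith),
    show 4 * (x - 1 / 4) - 1 = 4 * x - 2 by ring,
    show 8 * ((x + 1) / 2) - 6 = 4 * x - 2 by ring,
    show 4 * (x / 2 + 1 / 4) - 2 = (4 * x - 2) / 2 + 1 / 2 - 1 / 2 by ring,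
    add_sub_cancel_right, hc]
  simp only [zpow_zero, one_mul]
  suffices h : (-1) ^ breakBinv x * twistedPot (Binvmap x) =
      treePot (4 * x - 2) - treeFlow (4 * x - 2) by rw [h]; ring
  rcases lt_trichotomy x (5 / 8) with h | rfl | h
  · obtain ⟨hf, hp⟩ := treeFlow_half (u := 8 * x - 4) (by linarith) (by linarith)
    rw [show (8 * x - 4) / 2 = 4 * x - 2 by ring] at hf hp
    rw [breakBinv, if_neg (by linarith), if_neg (by linarith), if_neg (by linarith),
      Binvmap, if_neg (by linarith), if_pos h.le, twistedPot_mid (by linarith) (by linarith),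
      show 4 * (2 * x - 1 / 2) - 2 = 8 * x - 4 by ring, hf, hp]
    simp
  · have e : Binvmap (5 / 8) = 3 / 4 := by norm_num [Binvmap]
    have b : breakBinv (5 / 8) = -1 := by norm_num [breakBinv]
    rw [e, b, twistedPot_three_quarters, show (4 : ℝ) * (5 / 8) - 2 = 1 / 2 by norm_num,
      treePot_one_half, treeFlow_one_half]
    norm_num
  · obtain ⟨hf, hp⟩ := treeFlow_half_add (u := 8 * x - 5) (by linarith) (by linarith)
    rw [show (1 + (8 * x - 5)) / 2 = 4 * x - 2 by ring] at hf hp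
    rw [breakBinv, if_neg (by linarith), if_neg (by linarith), if_neg (by linarith),
      Binvmap, if_neg (by linarith), if_neg (by linarith), if_pos h1.le,
      twistedPot_high (by linarith) (by linarith),
      show 8 * (x + 1 / 8) - 6 = 8 * x - 5 by ring, hf, hp]
    simp only [zpow_zero, one_mul]
    ring

lemma twistedPot_harmonic_three_quarters :
    4 * twistedPot (3 / 4) = (-1) ^ breakA (3 / 4) * twistedPot (Amap (3 / 4)) +
      (-1) ^ breakAinv (3 / 4) * twistedPot (Ainvmap (3 / 4)) +
      (-1) ^ breakB (3 / 4) * twistedPot (Bmap (3 / 4)) +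
      (-1) ^ breakBinv (3 / 4) * twistedPot (Binvmap (3 / 4)) := by
  have e1 : Amap (3 / 4) = 1 / 2 := by norm_num [Amap]
  have e2 : Ainvmap (3 / 4) = 7 / 8 := by norm_num [Ainvmap]
  have e3 : Bmap (3 / 4) = 5 / 8 := by norm_num [Bmap]
  have e4 : Binvmap (3 / 4) = 7 / 8 := by norm_num [Binvmap]
  have b1 : breakA (3 / 4) = 1 := by norm_num [breakA]
  have b3 : breakB (3 / 4) = 1 := by norm_num [breakB]
  have h : twistedPot (5 / 8) = 19 := by
    rw [twistedPot_mid (by norm_num) (by norm_num),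
      show (4 : ℝ) * (5 / 8) - 2 = 1 / 2 by norm_num, treePot_one_half]
  rw [e1, e2, e3, e4, b1, b3, twistedPot_one_half, twistedPot_three_quarters, h,
    twistedPot_seven_eighths]
  norm_num

lemma twistedPot_harmonic_high {x : ℝ} (h0 : 3 / 4 < x) (h1 : x < 1) :
    4 * twistedPot x = (-1) ^ breakA x * twistedPot (Amap x) +
      (-1) ^ breakAinv x * twistedPot (Ainvmap x) +
      (-1) ^ breakB x * twistedPot (Bmap x) + (-1) ^ breakBinv x * twistedPot (Binvmap x) := by
  have e1 : Amap x = 2 * x - 1 := by rw [Amap, if_neg (by linarith), if_neg (by linarith)]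
  have e2 : Ainvmap x = (x + 1) / 2 := by rw [Ainvmap, if_neg (by linarith), if_neg (by linarith)]
  have e4 : Binvmap x = (x + 1) / 2 := by
    rw [Binvmap, if_neg (by linarith), if_neg (by linarith), if_neg (by linarith)]
  have b1 : breakA x = 0 := by
    rw [breakA, if_neg (by linarith), if_neg (by linarith)]
  have b2 : breakAinv x = 0 := by
    rw [breakAinv, if_neg (by linarith), if_neg (by linarith)]
  have b4 : breakBinv x = 0 := by
    rw [breakBinv, if_neg (by linarith), if_neg (by linarith), if_neg (by linarith)]
  rw [e1, e2, e4, b1, b2, b4, twistedPot_half_add h0 h1]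
  simp only [zpow_zero, one_mul]
  suffices h : twistedPot (2 * x - 1) + (-1) ^ breakB x * twistedPot (Bmap x) =
      2 * twistedPot x by linarith
  rcases lt_trichotomy x (7 / 8) with h | rfl | h
  · obtain ⟨-, hp⟩ := treeFlow_half_add (u := 8 * x - 6) (by linarith) (by linarith)
    rw [breakB, if_neg (by linarith), if_neg (by linarith), if_neg (by linarith),
      Bmap, if_neg (by linarith), if_neg (by linarith), if_pos h.le,
      twistedPot_mid (by linarith) (by linarith), twistedPot_mid (by linarith) (by linarith),
      twistedPot_high h0 h, show 4 * (x - 1 / 8) - 2 = (1 + (8 * x - 6)) / 2 by ring, hp,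
      show 4 * (2 * x - 1) - 2 = 8 * x - 6 by ring]
    simp only [zpow_zero, one_mul]
    ring
  · have e : Bmap (7 / 8) = 3 / 4 := by norm_num [Bmap]
    have b : breakB (7 / 8) = 1 := by norm_num [breakB]
    rw [e, b, twistedPot_seven_eighths, show (2 : ℝ) * (7 / 8) - 1 = 3 / 4 by norm_num,
      twistedPot_three_quarters]
    norm_num
  · have hx := twistedPot_half_add (x := 2 * x - 1) (by linarith) (by linarith)
    rw [sub_add_cancel, mul_div_cancel_left₀ _ two_ne_zero] at hx
    rw [breakB, if_neg (by linarith), if_neg (by linarith), if_neg (by linarith),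
      Bmap, if_neg (by linarith), if_neg (by linarith), if_neg (by linarith), hx]
    simp only [zpow_zero, one_mul]
    ring

lemma twistedPot_harmonic {x : ℝ} (h0 : 0 < x) (h1 : x < 1) :
    4 * twistedPot x = (-1) ^ breakA x * twistedPot (Amap x) +
      (-1) ^ breakAinv x * twistedPot (Ainvmap x) +
      (-1) ^ breakB x * twistedPot (Bmap x) + (-1) ^ breakBinv x * twistedPot (Binvmap x) := by
  rcases lt_trichotomy x (1 / 2) with h | rfl | h
  · exact twistedPot_harmonic_low h0 h
  · exact twistedPot_harmonic_one_half
  rcases lt_trichotomy x (3 / 4) with h' | rfl | h'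
  · exact twistedPot_harmonic_mid h h'
  · exact twistedPot_harmonic_three_quarters
  · exact twistedPot_harmonic_high h' h1

/-! ### The break cocycle -/

/-- `g` maps `x` into the open unit interval, and near `x` it is affine on both sides, the right
slope being `2 ^ k` times the left slope. -/
def HasBreak (g : Equiv.Perm (Icc (0 : ℝ) 1)) (x : Icc (0 : ℝ) 1) (k : ℤ) : Prop :=
  (0 < (g x : ℝ) ∧ (g x : ℝ) < 1) ∧ ∃ a > 0, ∃ δ > 0,
    (∀ y : Icc (0 : ℝ) 1, (x : ℝ) < y → (y : ℝ) < x + δ →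
      (g y : ℝ) = g x + a * 2 ^ k * (y - x)) ∧
    (∀ y : Icc (0 : ℝ) 1, (x : ℝ) - δ < y → (y : ℝ) < x → (g y : ℝ) = g x + a * (y - x))

lemma HasBreak.one {x : Icc (0 : ℝ) 1} (h0 : 0 < (x : ℝ)) (h1 : (x : ℝ) < 1) :
    HasBreak 1 x 0 :=
  ⟨⟨h0, h1⟩, 1, one_pos, 1, one_pos, by simp, by simp⟩

lemma HasBreak.mul {f g : Equiv.Perm (Icc (0 : ℝ) 1)} {x : Icc (0 : ℝ) 1} {k l : ℤ}
    (hf : HasBreak f (g x) l) (hg : HasBreak g x k) : HasBreak (f * g) x (l + k) := by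
  obtain ⟨-, a, ha, δ, hδ, hr, hl⟩ := hg
  obtain ⟨hfx, b, hb, ε, hε, hr', hl'⟩ := hf
  have hk : (0 : ℝ) < a * 2 ^ k := by positivity
  refine ⟨hfx, b * a, mul_pos hb ha, min δ (min (ε / a) (ε / (a * 2 ^ k))), by positivity, ?_, ?_⟩
  · intro y hy1 hy2
    have h1 : (y : ℝ) < x + δ := hy2.trans_le (by gcongr; exact min_le_left _ _)
    have h2 : (y : ℝ) - x < ε / (a * 2 ^ k) := by
      have := hy2.trans_le (add_le_add_right ((min_le_right _ _).trans (min_le_right _ _)) (x : ℝ))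
      linarith
    rw [lt_div_iff₀' hk] at h2
    have e := hr y hy1 h1
    have h3 := mul_pos hk (sub_pos.2 hy1)
    have e' := hr' (g y) (by linarith) (by linarith)
    change (f (g y) : ℝ) = f (g x) + _
    rw [e', e, zpow_add₀ two_ne_zero]
    ring
  · intro y hy1 hy2
    have h1 : (x : ℝ) - δ < y := lt_of_le_of_lt (by gcongr; exact min_le_left _ _) hy1
    have h2 : (x : ℝ) - y < ε / a := by
      have := add_le_add_right
        ((min_le_right δ _).trans (min_le_left (ε / a) (ε / (a * 2 ^ k)))) (x : ℝ)
      linarith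
    rw [lt_div_iff₀' ha] at h2
    have e := hl y h1 hy2
    have h3 := mul_pos ha (sub_pos.2 hy2)
    have e' := hl' (g y) (by linarith) (by linarith)
    change (f (g y) : ℝ) = f (g x) + _
    rw [e', e]
    ring

lemma HasBreak.unique {g : Equiv.Perm (Icc (0 : ℝ) 1)} {x : Icc (0 : ℝ) 1} {k l : ℤ}
    (h0 : 0 < (x : ℝ)) (h1 : (x : ℝ) < 1) (hgk : HasBreak g x k) (hgl : HasBreak g x l) :
    k = l := by
  obtain ⟨-, a, ha, δ, hδ, hr, hl⟩ := hgk
  obtain ⟨-, b, hb, ε, hε, hr', hl'⟩ := hgl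
  have hm : 0 < min δ ε := lt_min hδ hε
  obtain ⟨y, hy1, hy2⟩ := exists_between (show (x : ℝ) < min 1 (x + min δ ε) from
    lt_min h1 (by linarith))
  obtain ⟨z, hz1, hz2⟩ := exists_between (show max 0 (x - min δ ε) < (x : ℝ) from
    max_lt h0 (by linarith))
  rw [lt_min_iff] at hy2
  rw [max_lt_iff] at hz1
  have m1 := min_le_left δ ε
  have m2 := min_le_right δ ε
  have e1 := hr ⟨y, by constructor <;> linarith⟩ hy1 (by simp only; linarith)
  have e2 := hr' ⟨y, by constructor <;> linarith⟩ hy1 (by simp only; linarith)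
  have e3 := hl ⟨z, by constructor <;> linarith⟩ (by simp only; linarith) hz2
  have e4 := hl' ⟨z, by constructor <;> linarith⟩ (by simp only; linarith) hz2
  have hab : a = b :=
    mul_right_cancel₀ (show z - (x : ℝ) ≠ 0 by linarith) (by simp only at e3 e4; linarith)
  subst hab
  have hkl : a * (2 : ℝ) ^ k = a * 2 ^ l :=
    mul_right_cancel₀ (show y - (x : ℝ) ≠ 0 by linarith) (by simp only at e1 e2; linarith)
  exact zpow_right_injective₀ two_pos (by norm_num) (mul_left_cancel₀ ha.ne' hkl)

lemma HasBreak.of_affine {g : Equiv.Perm (Icc (0 : ℝ) 1)} {f : ℝ → ℝ}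
    (hgf : ∀ y, (g y : ℝ) = f y) {x : Icc (0 : ℝ) 1} (h : 0 < f x ∧ f x < 1)
    {k : ℤ} {l m n r a b c d : ℝ} (hl : ∀ y : ℝ, l ≤ y → y ≤ m → f y = a * y + c)
    (hr : ∀ y : ℝ, n ≤ y → y ≤ r → f y = b * y + d) (hlx : l < x) (hxm : x ≤ m) (hnx : n ≤ x)
    (hxr : x < r) (ha : 0 < a) (hb : b = a * 2 ^ k) : HasBreak g x k := by
  have hm : 0 < min (r - x) (x - l) := lt_min (by linarith) (by linarith)
  have m1 := min_le_left (r - x) (x - l)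
  have m2 := min_le_right (r - x) (x - l)
  refine ⟨by rwa [hgf], a, ha, min (r - x) (x - l), hm, ?_, ?_⟩
  · intro y hy1 hy2
    rw [hgf, hgf, hr y (by linarith) (by linarith), hr x hnx hxr.le, hb]
    ring
  · intro y hy1 hy2
    rw [hgf, hgf, hl y (by linarith) (by linarith), hl x hlx.le hxm]
    ring

lemma hasBreak_A {x : Icc (0 : ℝ) 1} (h0 : 0 < (x : ℝ)) (h1 : (x : ℝ) < 1) :
    HasBreak permA x (breakA x) := by
  have hgf : ∀ y : Icc (0 : ℝ) 1, (permA y : ℝ) = Amap y := fun _ => rfl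
  have hf : 0 < Amap x ∧ Amap x < 1 := by
    unfold Amap; split_ifs <;> constructor <;> linarith
  have p1 : ∀ y : ℝ, 0 ≤ y → y ≤ 1 / 2 → Amap y = 1 / 2 * y + 0 := by
    intro y _ _; unfold Amap; split_ifs <;> linarith
  have p2 : ∀ y : ℝ, 1 / 2 ≤ y → y ≤ 3 / 4 → Amap y = 1 * y + (-1 / 4) := by
    intro y _ _; unfold Amap; split_ifs <;> linarith
  have p3 : ∀ y : ℝ, 3 / 4 ≤ y → y ≤ 1 → Amap y = 2 * y + (-1) := by
    intro y _ _; unfold Amap; split_ifs <;> linarith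
  unfold breakA
  rcases lt_trichotomy (x : ℝ) (1 / 2) with h | h | h
  · rw [if_neg (by linarith), if_neg (by linarith)]
    refine .of_affine hgf hf p1 p1 ?_ ?_ ?_ ?_ ?_ ?_ <;> linarith
  · rw [if_pos h]
    refine .of_affine hgf hf p1 p2 ?_ ?_ ?_ ?_ ?_ ?_ <;> linarith
  rcases lt_trichotomy (x : ℝ) (3 / 4) with h | h | h
  · rw [if_neg (by linarith), if_neg (by linarith)]
    refine .of_affine hgf hf p2 p2 ?_ ?_ ?_ ?_ ?_ ?_ <;> linarith
  · rw [if_neg (by linarith), if_pos h]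
    refine .of_affine hgf hf p2 p3 ?_ ?_ ?_ ?_ ?_ ?_ <;> linarith
  rw [if_neg (by linarith), if_neg (by linarith)]
  refine .of_affine hgf hf p3 p3 ?_ ?_ ?_ ?_ ?_ ?_ <;> linarith

lemma hasBreak_A_inv {x : Icc (0 : ℝ) 1} (h0 : 0 < (x : ℝ)) (h1 : (x : ℝ) < 1) :
    HasBreak permA⁻¹ x (breakAinv x) := by
  have hgf : ∀ y : Icc (0 : ℝ) 1, ((permA⁻¹) y : ℝ) = Ainvmap y := fun _ => rfl
  have hf : 0 < Ainvmap x ∧ Ainvmap x < 1 := by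
    unfold Ainvmap; split_ifs <;> constructor <;> linarith
  have p1 : ∀ y : ℝ, 0 ≤ y → y ≤ 1 / 4 → Ainvmap y = 2 * y + 0 := by
    intro y _ _; unfold Ainvmap; split_ifs <;> linarith
  have p2 : ∀ y : ℝ, 1 / 4 ≤ y → y ≤ 1 / 2 → Ainvmap y = 1 * y + 1 / 4 := by
    intro y _ _; unfold Ainvmap; split_ifs <;> linarith
  have p3 : ∀ y : ℝ, 1 / 2 ≤ y → y ≤ 1 → Ainvmap y = 1 / 2 * y + 1 / 2 := by
    intro y _ _; unfold Ainvmap; split_ifs <;> linarith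
  unfold breakAinv
  rcases lt_trichotomy (x : ℝ) (1 / 4) with h | h | h
  · rw [if_neg (by linarith), if_neg (by linarith)]
    refine .of_affine hgf hf p1 p1 ?_ ?_ ?_ ?_ ?_ ?_ <;> linarith
  · rw [if_pos h]
    refine .of_affine hgf hf p1 p2 ?_ ?_ ?_ ?_ ?_ ?_ <;> first | linarith | norm_num
  rcases lt_trichotomy (x : ℝ) (1 / 2) with h | h | h
  · rw [if_neg (by linarith), if_neg (by linarith)]
    refine .of_affine hgf hf p2 p2 ?_ ?_ ?_ ?_ ?_ ?_ <;> linarith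
  · rw [if_neg (by linarith), if_pos h]
    refine .of_affine hgf hf p2 p3 ?_ ?_ ?_ ?_ ?_ ?_ <;> linarith
  rw [if_neg (by linarith), if_neg (by linarith)]
  refine .of_affine hgf hf p3 p3 ?_ ?_ ?_ ?_ ?_ ?_ <;> linarith

lemma hasBreak_B {x : Icc (0 : ℝ) 1} (h0 : 0 < (x : ℝ)) (h1 : (x : ℝ) < 1) :
    HasBreak permB x (breakB x) := by
  have hgf : ∀ y : Icc (0 : ℝ) 1, (permB y : ℝ) = Bmap y := fun _ => rfl
  have hf : 0 < Bmap x ∧ Bmap x < 1 := by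
    unfold Bmap; split_ifs <;> constructor <;> linarith
  have p1 : ∀ y : ℝ, 0 ≤ y → y ≤ 1 / 2 → Bmap y = 1 * y + 0 := by
    intro y _ _; unfold Bmap; split_ifs <;> linarith
  have p2 : ∀ y : ℝ, 1 / 2 ≤ y → y ≤ 3 / 4 → Bmap y = 1 / 2 * y + 1 / 4 := by
    intro y _ _; unfold Bmap; split_ifs <;> linarith
  have p3 : ∀ y : ℝ, 3 / 4 ≤ y → y ≤ 7 / 8 → Bmap y = 1 * y + (-1 / 8) := by
    intro y _ _; unfold Bmap; split_ifs <;> linarith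
  have p4 : ∀ y : ℝ, 7 / 8 ≤ y → y ≤ 1 → Bmap y = 2 * y + (-1) := by
    intro y _ _; unfold Bmap; split_ifs <;> linarith
  unfold breakB
  rcases lt_trichotomy (x : ℝ) (1 / 2) with h | h | h
  · rw [if_neg (by linarith), if_neg (by linarith), if_neg (by linarith)]
    refine .of_affine hgf hf p1 p1 ?_ ?_ ?_ ?_ ?_ ?_ <;> linarith
  · rw [if_pos h]
    refine .of_affine hgf hf p1 p2 ?_ ?_ ?_ ?_ ?_ ?_ <;> linarith
  rcases lt_trichotomy (x : ℝ) (3 / 4) with h | h | h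
  · rw [if_neg (by linarith), if_neg (by linarith), if_neg (by linarith)]
    refine .of_affine hgf hf p2 p2 ?_ ?_ ?_ ?_ ?_ ?_ <;> linarith
  · rw [if_neg (by linarith), if_pos h]
    refine .of_affine hgf hf p2 p3 ?_ ?_ ?_ ?_ ?_ ?_ <;> linarith
  rcases lt_trichotomy (x : ℝ) (7 / 8) with h | h | h
  · rw [if_neg (by linarith), if_neg (by linarith), if_neg (by linarith)]
    refine .of_affine hgf hf p3 p3 ?_ ?_ ?_ ?_ ?_ ?_ <;> linarith
  · rw [if_neg (by linarith), if_neg (by linarith), if_pos h]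
    refine .of_affine hgf hf p3 p4 ?_ ?_ ?_ ?_ ?_ ?_ <;> linarith
  rw [if_neg (by linarith), if_neg (by linarith), if_neg (by linarith)]
  refine .of_affine hgf hf p4 p4 ?_ ?_ ?_ ?_ ?_ ?_ <;> linarith

lemma hasBreak_B_inv {x : Icc (0 : ℝ) 1} (h0 : 0 < (x : ℝ)) (h1 : (x : ℝ) < 1) :
    HasBreak permB⁻¹ x (breakBinv x) := by
  have hgf : ∀ y : Icc (0 : ℝ) 1, ((permB⁻¹) y : ℝ) = Binvmap y := fun _ => rfl
  have hf : 0 < Binvmap x ∧ Binvmap x < 1 := by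
    unfold Binvmap; split_ifs <;> constructor <;> linarith
  have p1 : ∀ y : ℝ, 0 ≤ y → y ≤ 1 / 2 → Binvmap y = 1 * y + 0 := by
    intro y _ _; unfold Binvmap; split_ifs <;> linarith
  have p2 : ∀ y : ℝ, 1 / 2 ≤ y → y ≤ 5 / 8 → Binvmap y = 2 * y + (-1 / 2) := by
    intro y _ _; unfold Binvmap; split_ifs <;> linarith
  have p3 : ∀ y : ℝ, 5 / 8 ≤ y → y ≤ 3 / 4 → Binvmap y = 1 * y + 1 / 8 := by
    intro y _ _; unfold Binvmap; split_ifs <;> linarith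
  have p4 : ∀ y : ℝ, 3 / 4 ≤ y → y ≤ 1 → Binvmap y = 1 / 2 * y + 1 / 2 := by
    intro y _ _; unfold Binvmap; split_ifs <;> linarith
  unfold breakBinv
  rcases lt_trichotomy (x : ℝ) (1 / 2) with h | h | h
  · rw [if_neg (by linarith), if_neg (by linarith), if_neg (by linarith)]
    refine .of_affine hgf hf p1 p1 ?_ ?_ ?_ ?_ ?_ ?_ <;> linarith
  · rw [if_pos h]
    refine .of_affine hgf hf p1 p2 ?_ ?_ ?_ ?_ ?_ ?_ <;> linarith
  rcases lt_trichotomy (x : ℝ) (5 / 8) with h | h | h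
  · rw [if_neg (by linarith), if_neg (by linarith), if_neg (by linarith)]
    refine .of_affine hgf hf p2 p2 ?_ ?_ ?_ ?_ ?_ ?_ <;> linarith
  · rw [if_neg (by linarith), if_pos h]
    refine .of_affine hgf hf p2 p3 ?_ ?_ ?_ ?_ ?_ ?_ <;> first | linarith | norm_num
  rcases lt_trichotomy (x : ℝ) (3 / 4) with h | h | h
  · rw [if_neg (by linarith), if_neg (by linarith), if_neg (by linarith)]
    refine .of_affine hgf hf p3 p3 ?_ ?_ ?_ ?_ ?_ ?_ <;> linarith
  · rw [if_neg (by linarith), if_neg (by linarith), if_pos h]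
    refine .of_affine hgf hf p3 p4 ?_ ?_ ?_ ?_ ?_ ?_ <;> linarith
  rw [if_neg (by linarith), if_neg (by linarith), if_neg (by linarith)]
  refine .of_affine hgf hf p4 p4 ?_ ?_ ?_ ?_ ?_ ?_ <;> linarith

lemma exists_hasBreak {g : Equiv.Perm (Icc (0 : ℝ) 1)} (hg : g ∈ thompsonF)
    {x : Icc (0 : ℝ) 1} (h0 : 0 < (x : ℝ)) (h1 : (x : ℝ) < 1) : ∃ k, HasBreak g x k := by
  induction hg using Subgroup.closure_induction_left generalizing x with
  | one => exact ⟨0, .one h0 h1⟩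
  | mul_left s hs g _ ih =>
    obtain ⟨k, hk⟩ := ih h0 h1
    rcases hs with rfl | rfl
    · exact ⟨_, (hasBreak_A hk.1.1 hk.1.2).mul hk⟩
    · exact ⟨_, (hasBreak_B hk.1.1 hk.1.2).mul hk⟩
  | inv_mul_cancel s hs g _ ih =>
    obtain ⟨k, hk⟩ := ih h0 h1
    rcases hs with rfl | rfl
    · exact ⟨_, (hasBreak_A_inv hk.1.1 hk.1.2).mul hk⟩
    · exact ⟨_, (hasBreak_B_inv hk.1.1 hk.1.2).mul hk⟩

/-- The midpoint of the unit interval. -/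
noncomputable def midpt : Icc (0 : ℝ) 1 := ⟨1 / 2, by norm_num, by norm_num⟩

lemma midpt_pos : 0 < (midpt : ℝ) := one_half_pos

lemma midpt_lt_one : (midpt : ℝ) < 1 := one_half_lt_one

/-- Exponent of the break of `g` at `1 / 2`. -/
noncomputable def breakMid (g : thompsonF) : ℤ :=
  (exists_hasBreak g.2 midpt_pos midpt_lt_one).choose

lemma breakMid_spec (g : thompsonF) : HasBreak g midpt (breakMid g) :=
  (exists_hasBreak g.2 midpt_pos midpt_lt_one).choose_spec

lemma breakMid_eq {g : thompsonF} {k : ℤ} (h : HasBreak g midpt k) : breakMid g = k :=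
  (breakMid_spec g).unique midpt_pos midpt_lt_one h

/-- The harmonic function on `F`. -/
noncomputable def harmonicFun (g : thompsonF) : ℝ :=
  (-1) ^ breakMid g⁻¹ * twistedPot ((g⁻¹ : thompsonF).1 midpt)

lemma harmonicFun_mul_inv (g s : thompsonF) {k : ℤ}
    (h : HasBreak s.1 ((g⁻¹ : thompsonF).1 midpt) k) :
    harmonicFun (g * s⁻¹) = (-1) ^ breakMid g⁻¹ *
      ((-1) ^ k * twistedPot (s.1 ((g⁻¹ : thompsonF).1 midpt))) := by
  have e : (g * s⁻¹)⁻¹ = s * g⁻¹ := by group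
  have hb : breakMid (s * g⁻¹) = k + breakMid g⁻¹ := breakMid_eq (h.mul (breakMid_spec g⁻¹))
  rw [harmonicFun, e, hb, zpow_add₀ (by norm_num)]
  change _ * twistedPot (s.1 ((g⁻¹ : thompsonF).1 midpt)) = _
  ring

lemma harmonicFun_one : harmonicFun 1 = 1 := by
  have hb : breakMid 1 = 0 := breakMid_eq (.one midpt_pos midpt_lt_one)
  rw [harmonicFun, inv_one, hb, zpow_zero, one_mul]
  exact twistedPot_one_half

lemma harmonicFun_genB_inv : harmonicFun (1 * genB⁻¹) = -1 := by
  have hb : breakMid 1 = 0 := breakMid_eq (.one midpt_pos midpt_lt_one)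
  rw [harmonicFun_mul_inv 1 genB (hasBreak_B (breakMid_spec 1⁻¹).1.1 (breakMid_spec 1⁻¹).1.2),
    inv_one, hb]
  have h1 : breakB (((1 : thompsonF).1 midpt : Icc (0 : ℝ) 1) : ℝ) = -1 := if_pos rfl
  have h2 : ((genB.1 ((1 : thompsonF).1 midpt) : Icc (0 : ℝ) 1) : ℝ) = 1 / 2 := if_pos le_rfl
  rw [h1, h2, twistedPot_one_half]
  norm_num

/-- Thompson's group `F` is not Liouville: there is a bounded nonconstant function on `F`
harmonic for the simple random walk driven by the uniform measure on `{A, A⁻¹, B, B⁻¹}`. -/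
theorem thompsonF_not_liouville :
    ∃ h : thompsonF → ℝ, (∃ M : ℝ, ∀ g, |h g| ≤ M) ∧ (∃ g1 g2, h g1 ≠ h g2) ∧
      ∀ g : thompsonF,
        h g = (1/4) * (h (g * genA) + h (g * genA⁻¹) + h (g * genB) + h (g * genB⁻¹)) := by
  refine ⟨harmonicFun, ⟨61, fun g => ?_⟩, ⟨1, 1 * genB⁻¹, ?_⟩, fun g => ?_⟩
  · rw [harmonicFun, abs_mul, abs_zpow, abs_neg, abs_one, one_zpow, one_mul]
    exact abs_twistedPot_le _
  · rw [harmonicFun_one, harmonicFun_genB_inv]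
    norm_num
  · obtain ⟨h0, h1⟩ := (breakMid_spec g⁻¹).1
    have hA := harmonicFun_mul_inv g genA (hasBreak_A h0 h1)
    have hA' := harmonicFun_mul_inv g genA⁻¹ (hasBreak_A_inv h0 h1)
    have hB := harmonicFun_mul_inv g genB (hasBreak_B h0 h1)
    have hB' := harmonicFun_mul_inv g genB⁻¹ (hasBreak_B_inv h0 h1)
    rw [inv_inv] at hA' hB'
    rw [hA, hA', hB, hB', harmonicFun]
    have h := twistedPot_harmonic h0 h1
    change 4 * twistedPot _ = _ * twistedPot (genA.1 ((g⁻¹ : thompsonF).1 midpt)) +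
      _ * twistedPot ((genA⁻¹ : thompsonF).1 ((g⁻¹ : thompsonF).1 midpt)) +
      _ * twistedPot (genB.1 ((g⁻¹ : thompsonF).1 midpt)) +
      _ * twistedPot ((genB⁻¹ : thompsonF).1 ((g⁻¹ : thompsonF).1 midpt)) at h
    linear_combination (1 / 4) * (-1) ^ breakMid g⁻¹ * h
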